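/- No polynomial automorphism of ℂ² is chaotic: if f : ℂ² → ℂ² is a bijection such that both f and f⁻¹ are given componentwise by polynomials, then f does not simultaneously have a dense forward orbit and a dense set of periodic points. -/

import Mathlib

open Topology Filter Metric Set Function

noncomputable section

/-- ℂⁿ with the Euclidean norm. -/
abbrev En (n : ℕ) : Type := EuclideanSpace ℂ (Fin n)

/-- A holomorphic automorphism of ℂⁿ: a bijection that is holomorphic with holomorphic inverse. -/
def IsHoloAut {n : ℕ} (f : En n → En n) : Prop :=
  Differentiable ℂ f ∧ ∃ g : En n → En n, Differentiable ℂ g ∧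
    Function.LeftInverse g f ∧ Function.RightInverse g f

/-- Volume-preserving with respect to ω₀ = dz₁∧⋯∧dzₙ: det Df(z) = 1 for all z. -/
def IsVolPres {n : ℕ} (f : En n → En n) : Prop :=
  ∀ z : En n, (fderiv ℂ f z).det = 1

/-- Aut(ℂⁿ) as a subset of C(ℂⁿ, ℂⁿ) with the compact-open topology. -/
def AutCN (n : ℕ) : Set C(En n, En n) := {f | IsHoloAut ⇑f}

/-- Aut_{ω₀}(ℂⁿ) as a subset of C(ℂⁿ, ℂⁿ) with the compact-open topology. -/
def AutOmega (n : ℕ) : Set C(En n, En n) := {f | IsHoloAut ⇑f ∧ IsVolPres ⇑f}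

/-- A continuous self-map is chaotic if it has a dense forward orbit and its set of
periodic points is dense. -/
def Chaotic {α : Type*} [TopologicalSpace α] (f : α → α) : Prop :=
  (∃ x : α, Dense (Set.range fun k : ℕ => f^[k] x)) ∧
  Dense {x : α | ∃ k : ℕ, 0 < k ∧ f^[k] x = x}

/-- Expelling: the set of points with unbounded forward orbit is dense. -/
def Expelling {n : ℕ} (f : En n → En n) : Prop :=
  Dense {x : En n | ¬ Bornology.IsBounded (Set.range fun k : ℕ => f^[k] x)}

/-- p is a hyperbolic fixed point of f: f(p) = p and no eigenvalue of Df(p) has modulus 1. -/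
def HypFixedPt {n : ℕ} (f : En n → En n) (p : En n) : Prop :=
  f p = p ∧ ∀ μ : ℂ, Module.End.HasEigenvalue
    ((fderiv ℂ f p : En n →ₗ[ℂ] En n) : Module.End ℂ (En n)) μ → ‖μ‖ ≠ 1

/-- The stable manifold of a fixed point p of f: points whose forward orbit tends to p. -/
def StableSet {n : ℕ} (f : En n → En n) (p : En n) : Set (En n) :=
  {x : En n | Tendsto (fun k : ℕ => f^[k] x) atTop (𝓝 p)}

/-- A map ℂ² → ℂ² given componentwise by polynomials in the two complex coordinates. -/
def IsPolyMap (f : En 2 → En 2) : Prop :=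
  ∀ i : Fin 2, ∃ p : MvPolynomial (Fin 2) ℂ,
    ∀ z : En 2, f z i = MvPolynomial.eval (fun j => z j) p

section AuxA
open MvPolynomial
abbrev A2 : Type := MvPolynomial (Fin 2) ℂ

abbrev Der2 : Type := Derivation ℂ A2 A2

def LND (D : Der2) : Prop := ∀ h, ∃ n : ℕ, (⇑D)^[n] h = 0

lemma iter_zero' (D : Der2) (n : ℕ) : (⇑D)^[n] 0 = 0 := by
  induction n with
  | zero => rfl
  | succ n ih => rw [Function.iterate_succ_apply, map_zero, ih]

lemma iter_add' (D : Der2) (n : ℕ) (a b : A2) :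
    (⇑D)^[n] (a + b) = (⇑D)^[n] a + (⇑D)^[n] b := by
  induction n generalizing a b with
  | zero => rfl
  | succ n ih => rw [Function.iterate_succ_apply, map_add, ih]; rfl

lemma iter_le (D : Der2) {n m : ℕ} (h : n ≤ m) {a : A2} (ha : (⇑D)^[n] a = 0) :
    (⇑D)^[m] a = 0 := by
  obtain ⟨k, rfl⟩ := Nat.exists_eq_add_of_le' h
  rw [Function.iterate_add_apply, ha, iter_zero']

lemma iter_smul_ker (D : Der2) (n : ℕ) {a : A2} (ha : D a = 0) (b : A2) :
    (⇑D)^[n] (a * b) = a * (⇑D)^[n] b := by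
  induction n generalizing b with
  | zero => rfl
  | succ n ih =>
    rw [Function.iterate_succ_apply, Derivation.leibniz, ha, smul_zero, add_zero, smul_eq_mul, ih]
    rfl

lemma leib_top (D : Der2) : ∀ (N n m : ℕ), n + m = N → ∀ (g h : A2), (⇑D)^[n+1] g = 0 →
    (⇑D)^[m+1] h = 0 →
    (⇑D)^[n+m] (g * h) = ((n+m).choose n : A2) * ((⇑D)^[n] g * (⇑D)^[m] h) := by
  intro N
  induction N with
  | zero =>
    intro n m hnm g h hg hh
    obtain ⟨rfl, rfl⟩ : n = 0 ∧ m = 0 := by omega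
    simp
  | succ N ih =>
    intro n m hnm g h hg hh
    rcases Nat.eq_zero_or_pos n with rfl | hn
    · simp only [zero_add, Nat.choose_zero_right, Nat.cast_one, one_mul]
      rw [iter_smul_ker D m (by simpa using hg)]
      rfl
    rcases Nat.eq_zero_or_pos m with rfl | hm
    · simp only [add_zero, Nat.choose_self, Nat.cast_one, one_mul]
      rw [mul_comm, iter_smul_ker D n (by simpa using hh), mul_comm]
      rfl
    obtain ⟨n, rfl⟩ := Nat.exists_eq_succ_of_ne_zero hn.ne'
    obtain ⟨m, rfl⟩ := Nat.exists_eq_succ_of_ne_zero hm.ne'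
    have e : n.succ + m.succ = (n + m.succ) + 1 := by omega
    have e2 : n + m.succ = n.succ + m := by omega
    have h1 := ih n m.succ (by omega) (D g) h (by simpa [Function.iterate_succ_apply] using hg) hh
    have h2 := ih n.succ m (by omega) g (D h) hg (by simpa [Function.iterate_succ_apply] using hh)
    rw [e, Function.iterate_succ_apply, Derivation.leibniz, smul_eq_mul, smul_eq_mul, iter_add',
      mul_comm h, h1, e2, h2, ← Function.iterate_succ_apply, ← Function.iterate_succ_apply]
    have e3 : (n.succ + m + 1).choose n.succ = (n.succ + m).choose n + (n.succ+m).choose n.succ :=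
      Nat.choose_succ_succ _ _
    rw [e3]
    push_cast
    ring

lemma leib_top_succ (D : Der2) (n m : ℕ) (g h : A2) (hg : (⇑D)^[n+1] g = 0)
    (hh : (⇑D)^[m+1] h = 0) : (⇑D)^[n+m+1] (g * h) = 0 := by
  rw [Function.iterate_succ_apply', leib_top D _ n m rfl g h hg hh]
  rw [Function.iterate_succ_apply'] at hg hh
  simp [Derivation.leibniz, hg, hh]

def Dg (D : Der2) (n : ℕ) (h : A2) : Prop := (⇑D)^[n] h ≠ 0 ∧ (⇑D)^[n+1] h = 0

lemma Dg.unique {D : Der2} {n m : ℕ} {h : A2} (a : Dg D n h) (b : Dg D m h) : n = m := by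
  rcases lt_trichotomy n m with h1 | h1 | h1
  · exact absurd (iter_le D h1 a.2) b.1
  · exact h1
  · exact absurd (iter_le D h1 b.2) a.1

lemma LND.exists_dg {D : Der2} (hD : LND D) {h : A2} (hh : h ≠ 0) : ∃ n, Dg D n h := by
  classical
  have hex := hD h
  have h0 : Nat.find hex ≠ 0 := by
    intro h0
    have := Nat.find_spec hex
    rw [h0] at this
    exact hh this
  obtain ⟨k, hk⟩ := Nat.exists_eq_succ_of_ne_zero h0
  refine ⟨k, Nat.find_min hex (by omega), ?_⟩
  have := Nat.find_spec hex
  rwa [hk] at this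

lemma Dg.mul {D : Der2} {n m : ℕ} {g h : A2} (a : Dg D n g) (b : Dg D m h) :
    Dg D (n + m) (g * h) := by
  refine ⟨?_, leib_top_succ D n m g h a.2 b.2⟩
  rw [leib_top D _ n m rfl g h a.2 b.2]
  have : ((n+m).choose n : A2) ≠ 0 := by
    exact_mod_cast (Nat.choose_pos (Nat.le_add_right n m)).ne'
  exact mul_ne_zero this (mul_ne_zero a.1 b.1)

lemma LND.ker_factor {D : Der2} (hD : LND D) {g P : A2} (hP : P ≠ 0) (hDP : D P = 0)
    (hg : g ∣ P) : D g = 0 := by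
  obtain ⟨h, rfl⟩ := hg
  obtain ⟨n, hn⟩ := hD.exists_dg (left_ne_zero_of_mul hP)
  obtain ⟨m, hm⟩ := hD.exists_dg (right_ne_zero_of_mul hP)
  have h0 : Dg D 0 (g * h) := ⟨hP, hDP⟩
  have := h0.unique (hn.mul hm)
  obtain rfl : n = 0 := by omega
  exact hn.2

lemma LND.cross {D : Der2} (hD : LND D) {x y : A2} (h1 : y ∣ D x) (h2 : x ∣ D y) :
    D x = 0 ∨ D y = 0 := by
  by_contra! hc
  obtain ⟨hx, hy⟩ := hc
  have hx0 : x ≠ 0 := by rintro rfl; simp at hx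
  have hy0 : y ≠ 0 := by rintro rfl; simp at hy
  obtain ⟨n, hn⟩ := hD.exists_dg hx0
  obtain ⟨m, hm⟩ := hD.exists_dg hy0
  obtain ⟨u, hu⟩ := h1
  obtain ⟨v, hv⟩ := h2
  obtain ⟨a, ha⟩ := hD.exists_dg (h := u) (by rintro rfl; simp [hu] at hx)
  obtain ⟨b, hb⟩ := hD.exists_dg (h := v) (by rintro rfl; simp [hv] at hy)
  have e1 := hm.mul ha
  rw [← hu] at e1
  have e2 := hn.mul hb
  rw [← hv] at e2
  have k1 : Dg D (m + a + 1) x := by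
    constructor
    · exact e1.1
    · exact e1.2
  have k2 : Dg D (n + b + 1) y := ⟨e2.1, e2.2⟩
  have := k1.unique hn
  have := k2.unique hm
  omega

lemma LND.of_X {D : Der2} (h : ∀ i, ∃ n, (⇑D)^[n] (X i) = 0) : LND D := by
  intro p
  induction p using MvPolynomial.induction_on with
  | C a => exact ⟨1, by simp⟩
  | add p q hp hq =>
    obtain ⟨n, hn⟩ := hp
    obtain ⟨m, hm⟩ := hq
    refine ⟨max n m, ?_⟩
    rw [iter_add', iter_le D (le_max_left n m) hn, iter_le D (le_max_right n m) hm, add_zero]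
  | mul_X p i hp =>
    obtain ⟨n, hn⟩ := hp
    obtain ⟨m, hm⟩ := h i
    exact ⟨n + m + 1, leib_top_succ D n m _ _ (iter_le D (Nat.le_succ n) hn)
      (iter_le D (Nat.le_succ m) hm)⟩

lemma der_eq (D : Der2) (h : A2) :
    D h = pderiv 0 h * D (X 0) + pderiv 1 h * D (X 1) := by
  have : D = (D (X 0)) • (pderiv 0 : Der2) + (D (X 1)) • (pderiv 1 : Der2) := by
    apply MvPolynomial.derivation_ext
    intro i
    fin_cases i <;> simp [pderiv_X]
  conv_lhs => rw [this]
  simp [mul_comm]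

/-- conjugate of a derivation -/
def conjDer (Φ : A2 ≃ₐ[ℂ] A2) (D : Der2) : Der2 :=
  Derivation.mk' (Φ.toLinearMap ∘ₗ (D : A2 →ₗ[ℂ] A2) ∘ₗ Φ.symm.toLinearMap) (by
    intro a b
    simp [Derivation.leibniz])

lemma conjDer_apply (Φ : A2 ≃ₐ[ℂ] A2) (D : Der2) (h : A2) :
    conjDer Φ D h = Φ (D (Φ.symm h)) := rfl

lemma conjDer_lnd {Φ : A2 ≃ₐ[ℂ] A2} {D : Der2} (hD : LND D) : LND (conjDer Φ D) := by
  have key : ∀ n h, (⇑(conjDer Φ D))^[n] h = Φ ((⇑D)^[n] (Φ.symm h)) := by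
    intro n
    induction n with
    | zero => simp
    | succ n ih =>
      intro h
      rw [Function.iterate_succ_apply, ih, conjDer_apply]
      simp
  intro h
  obtain ⟨n, hn⟩ := hD (Φ.symm h)
  exact ⟨n, by rw [key, hn, map_zero]⟩

def Good (P : A2) : Prop := ∃ D : Der2, D ≠ 0 ∧ LND D ∧ D P = 0

lemma Good.map {P : A2} (h : Good P) (Φ : A2 ≃ₐ[ℂ] A2) : Good (Φ P) := by
  obtain ⟨D, h0, h1, h2⟩ := h
  refine ⟨conjDer Φ D, ?_, conjDer_lnd h1, by simp [conjDer_apply, h2]⟩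
  intro hc
  apply h0
  ext1 i
  have := congrArg (fun E : Der2 => E (Φ (X i))) hc
  simpa [conjDer_apply] using this

lemma lnd_pderiv_one : LND (pderiv 1 : Der2) := by
  apply LND.of_X
  intro i
  fin_cases i
  · exact ⟨1, by simp [pderiv_X]⟩
  · exact ⟨2, by simp [pderiv_X]⟩

end AuxA

section AuxB
open MvPolynomial
/-- weight of an exponent -/
def wt (w : ℤ × ℤ) (m : Fin 2 →₀ ℕ) : ℤ := w.1 * m 0 + w.2 * m 1

lemma wt_add (w : ℤ × ℤ) (m n : Fin 2 →₀ ℕ) : wt w (m + n) = wt w m + wt w n := by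
  simp [wt]; ring

def InW (w : ℤ × ℤ) (S : Set ℤ) (h : A2) : Prop := ∀ m, coeff m h ≠ 0 → wt w m ∈ S

variable {w : ℤ × ℤ}

lemma InW.mono {S T : Set ℤ} {h : A2} (hh : InW w S h) (hST : S ⊆ T) : InW w T h :=
  fun m hm => hST (hh m hm)

lemma InW.zero (S : Set ℤ) : InW w S 0 := fun m hm => absurd (coeff_zero m) hm

lemma InW.add {S : Set ℤ} {g h : A2} (hg : InW w S g) (hh : InW w S h) : InW w S (g + h) := by
  intro m hm
  by_cases h1 : coeff m g = 0
  · apply hh; intro h2; apply hm; simp [h1, h2]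
  · exact hg m h1

lemma InW.neg {S : Set ℤ} {g : A2} (hg : InW w S g) : InW w S (-g) := by
  intro m hm
  apply hg; simpa using hm

lemma InW.sub {S : Set ℤ} {g h : A2} (hg : InW w S g) (hh : InW w S h) : InW w S (g - h) := by
  rw [sub_eq_add_neg]; exact hg.add hh.neg

lemma InW.mul {S T U : Set ℤ} {g h : A2} (hg : InW w S g) (hh : InW w T h)
    (hU : ∀ a ∈ S, ∀ b ∈ T, a + b ∈ U) : InW w U (g * h) := by
  classical
  intro m hm
  rw [coeff_mul] at hm
  obtain ⟨⟨a, b⟩, hx, hne⟩ := Finset.exists_ne_zero_of_sum_ne_zero hm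
  rw [Finset.HasAntidiagonal.mem_antidiagonal] at hx
  simp only at hx hne
  rw [← hx, wt_add]
  exact hU _ (hg a (left_ne_zero_of_mul hne)) _ (hh b (right_ne_zero_of_mul hne))

lemma InW.C (c : ℂ) : InW w {0} (MvPolynomial.C c) := by
  classical
  intro m hm
  rw [coeff_C] at hm
  obtain rfl : 0 = m := by by_contra h; simp [h] at hm
  simp [wt]

lemma InW.X0 : InW w {w.1} (X 0 : A2) := by
  classical
  intro m hm
  rw [coeff_X] at hm
  obtain rfl : Finsupp.single 0 1 = m := by by_contra h; simp [h] at hm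
  simp [wt]

lemma InW.X1 : InW w {w.2} (X 1 : A2) := by
  classical
  intro m hm
  rw [coeff_X] at hm
  obtain rfl : Finsupp.single 1 1 = m := by by_contra h; simp [h] at hm
  simp [wt]

lemma InW.pow {a : ℤ} {g : A2} (hg : InW w {a} g) (n : ℕ) : InW w {n * a} (g ^ n) := by
  induction n with
  | zero => simpa using InW.C (w := w) 1
  | succ n ih =>
    rw [pow_succ]
    refine ih.mul hg ?_
    simp; ring

lemma InW.pderiv0 {S T : Set ℤ} {g : A2} (hg : InW w S g) (hT : ∀ a ∈ S, a - w.1 ∈ T) :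
    InW w T (pderiv 0 g) := by
  intro m hm
  rw [coeff_pderiv] at hm
  have := hT _ (hg _ (left_ne_zero_of_mul hm))
  rw [wt_add] at this
  simpa [wt] using this

lemma InW.pderiv1 {S T : Set ℤ} {g : A2} (hg : InW w S g) (hT : ∀ a ∈ S, a - w.2 ∈ T) :
    InW w T (pderiv 1 g) := by
  intro m hm
  rw [coeff_pderiv] at hm
  have := hT _ (hg _ (left_ne_zero_of_mul hm))
  rw [wt_add] at this
  simpa [wt] using this

lemma InW.der {S T U V : Set ℤ} {D : Der2} {g : A2} (hg : InW w S g)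
    (h0 : InW w T (D (X 0))) (h1 : InW w U (D (X 1)))
    (hT : ∀ a ∈ S, ∀ b ∈ T, a - w.1 + b ∈ V) (hU : ∀ a ∈ S, ∀ b ∈ U, a - w.2 + b ∈ V) :
    InW w V (D g) := by
  rw [der_eq]
  refine InW.add (InW.mul (S := (fun a => a - w.1) '' S) (hg.pderiv0 ?_) h0 ?_)
    (InW.mul (S := (fun a => a - w.2) '' S) (hg.pderiv1 ?_) h1 ?_)
  · intro a ha; exact ⟨a, ha, rfl⟩
  · rintro _ ⟨a, ha, rfl⟩ b hb; exact hT a ha b hb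
  · intro a ha; exact ⟨a, ha, rfl⟩
  · rintro _ ⟨a, ha, rfl⟩ b hb; exact hU a ha b hb

lemma InW.eq_zero {S T : Set ℤ} {g : A2} (hg : InW w S g) (hg' : InW w T g)
    (h : Disjoint S T) : g = 0 := by
  ext m
  rw [coeff_zero]
  by_contra hm
  exact Set.disjoint_left.mp h (hg m hm) (hg' m hm)

/-- top homogeneous part -/
def tp (w : ℤ × ℤ) (d : ℤ) (h : A2) : A2 :=
  ∑ m ∈ h.support with wt w m = d, monomial m (coeff m h)

lemma coeff_tp (d : ℤ) (h : A2) (m : Fin 2 →₀ ℕ) :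
    coeff m (tp w d h) = if wt w m = d then coeff m h else 0 := by
  classical
  simp only [tp, coeff_sum, coeff_monomial, Finset.sum_ite_eq', Finset.mem_filter, mem_support_iff]
  by_cases h1 : coeff m h = 0 <;> simp [h1]

lemma tp_hom (d : ℤ) (h : A2) : InW w {d} (tp w d h) := by
  intro m hm
  rw [coeff_tp] at hm
  by_contra hc
  exact hm (if_neg hc)

def Lead (w : ℤ × ℤ) (d : ℤ) (h t : A2) : Prop := InW w {d} t ∧ InW w (Iic (d - 1)) (h - t)

lemma lead_tp {d : ℤ} {h : A2} (hh : InW w (Iic d) h) : Lead w d h (tp w d h) := by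
  refine ⟨tp_hom d h, ?_⟩
  intro m hm
  rw [coeff_sub, coeff_tp] at hm
  have h1 : wt w m ≠ d := by intro h1; simp [h1] at hm
  rw [if_neg h1, sub_zero] at hm
  have h2 := hh m hm
  simp only [Set.mem_Iic] at h2 ⊢
  omega

lemma Lead.le {d : ℤ} {h t : A2} (hl : Lead w d h t) : InW w (Iic d) h := by
  have := (hl.2.mono (T := Iic d) (by intro a; simp only [Set.mem_Iic]; omega)).add
    (hl.1.mono (T := Iic d) (by intro a ha; exact le_of_eq ha))
  simpa using this

lemma Lead.eq_zero {d : ℤ} {t : A2} (hl : Lead w d 0 t) : t = 0 := by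
  have h2 := hl.2.neg
  rw [zero_sub, neg_neg] at h2
  refine hl.1.eq_zero h2 ?_
  simp

lemma Lead.der {d s : ℤ} {D E : Der2} (h0 : Lead w (w.1 + s) (D (X 0)) (E (X 0)))
    (h1 : Lead w (w.2 + s) (D (X 1)) (E (X 1))) {h t : A2} (hl : Lead w d h t) :
    Lead w (d + s) (D h) (E t) := by
  refine ⟨hl.1.der h0.1 h1.1 ?_ ?_, ?_⟩
  · simp; ring
  · simp; ring
  have : D h - E t = D (h - t) + (D - E) t := by
    rw [Derivation.sub_apply, map_sub]; ring
  rw [this]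
  refine InW.add (hl.2.der h0.le h1.le ?_ ?_) (hl.1.der (D := D - E) h0.2 h1.2 ?_ ?_) <;>
  · simp only [Set.mem_Iic, Set.mem_singleton_iff]; intros; omega

/-- The main leading-form lemma. -/
lemma Good.tp (hw1 : 0 < w.1) (hw2 : 0 < w.2) {P : A2} (hP : Good P) {d : ℤ}
    (hd : InW w (Iic d) P) : Good (tp w d P) := by
  classical
  obtain ⟨D, hD0, hD, hDP⟩ := hP
  let Q : ℤ → Prop := fun s => InW w (Iic (w.1 + s)) (D (X 0)) ∧ InW w (Iic (w.2 + s)) (D (X 1))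
  have hbdd : ∀ h : A2, ∃ B : ℤ, ∀ m, coeff m h ≠ 0 → wt w m ≤ B := by
    intro h
    obtain ⟨B, hB⟩ := (h.support.image (wt w)).bddAbove
    refine ⟨B, fun m hm => hB ?_⟩
    simp only [Finset.coe_image, Set.mem_image, Finset.mem_coe, mem_support_iff]
    exact ⟨m, hm, rfl⟩
  have hnn : ∀ m, 0 ≤ wt w m := fun m => by unfold wt; positivity
  obtain ⟨s, hs, hmin⟩ : ∃ s, Q s ∧ ∀ z, Q z → s ≤ z := by
    apply Int.exists_least_of_bdd
    · refine ⟨-w.1 - w.2, fun z hz => ?_⟩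
      by_contra! hc
      apply hD0
      ext1 i
      ext1 m
      by_contra hne
      fin_cases i
      · have := hz.1 m (by simpa using hne)
        have := hnn m
        simp only [Set.mem_Iic] at *
        omega
      · have := hz.2 m (by simpa using hne)
        have := hnn m
        simp only [Set.mem_Iic] at *
        omega
    · obtain ⟨B0, h0⟩ := hbdd (D (X 0))
      obtain ⟨B1, h1⟩ := hbdd (D (X 1))
      refine ⟨max B0 B1, fun m hm => ?_, fun m hm => ?_⟩
      · have := h0 m hm
        have := le_max_left B0 B1
        simp only [Set.mem_Iic]; omega
      · have := h1 m hm
        have := le_max_right B0 B1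
        simp only [Set.mem_Iic]; omega
  let E : Der2 := mkDerivation ℂ
    (fun i => if i = 0 then _root_.tp w (w.1 + s) (D (X 0)) else _root_.tp w (w.2 + s) (D (X 1)))
  have hE0 : E (X 0) = _root_.tp w (w.1 + s) (D (X 0)) := by simp [E, mkDerivation_X]
  have hE1 : E (X 1) = _root_.tp w (w.2 + s) (D (X 1)) := by simp [E, mkDerivation_X]
  have l0 : Lead w (w.1 + s) (D (X 0)) (E (X 0)) := by rw [hE0]; exact lead_tp hs.1
  have l1 : Lead w (w.2 + s) (D (X 1)) (E (X 1)) := by rw [hE1]; exact lead_tp hs.2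
  refine ⟨E, ?_, ?_, ?_⟩
  · intro hE
    have : Q (s - 1) := by
      have a0 := l0.2
      have a1 := l1.2
      rw [hE] at a0 a1
      simp only [Derivation.zero_apply, sub_zero] at a0 a1
      constructor
      · rw [← add_sub_assoc]; exact a0
      · rw [← add_sub_assoc]; exact a1
    have := hmin _ this
    omega
  · have key : ∀ (n : ℕ) (d : ℤ) (h t : A2), Lead w d h t →
        Lead w (d + n * s) ((⇑D)^[n] h) ((⇑E)^[n] t) := by
      intro n
      induction n with
      | zero => intro d h t hl; simpa using hl
      | succ n ih =>
        intro d h t hl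
        have := ih _ _ _ (Lead.der l0 l1 hl)
        rw [Function.iterate_succ_apply, Function.iterate_succ_apply]
        convert this using 1
        push_cast; ring
    apply LND.of_X
    intro i
    obtain ⟨n, hn⟩ := hD (X i)
    refine ⟨n, ?_⟩
    fin_cases i
    · have := key n w.1 (X 0) (X 0) ⟨InW.X0, by rw [sub_self]; exact InW.zero _⟩
      simp only [Fin.zero_eta] at hn ⊢
      rw [hn] at this
      exact this.eq_zero
    · have := key n w.2 (X 1) (X 1) ⟨InW.X1, by rw [sub_self]; exact InW.zero _⟩
      simp only [Fin.mk_one] at hn ⊢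
      rw [hn] at this
      exact this.eq_zero
  · have := Lead.der l0 l1 (lead_tp hd)
    rw [hDP] at this
    exact this.eq_zero

end AuxB

section AuxC
open MvPolynomial
lemma InW.sum {w : ℤ × ℤ} {S : Set ℤ} {ι : Type*} (s : Finset ι) (g : ι → A2)
    (h : ∀ i ∈ s, InW w S (g i)) : InW w S (∑ i ∈ s, g i) := by
  classical
  induction s using Finset.induction_on with
  | empty => simpa using InW.zero S
  | insert a s ha ih =>
    rw [Finset.sum_insert ha]
    exact (h a (Finset.mem_insert_self a s)).add
      (ih fun i hi => h i (Finset.mem_insert_of_mem hi))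

lemma mono_eq (m : Fin 2 →₀ ℕ) (c : ℂ) :
    (monomial m c : A2) = C c * (X 0 ^ m 0 * X 1 ^ m 1) := by
  rw [monomial_eq, Finsupp.prod_fintype _ _ (by simp)]
  simp [Fin.prod_univ_two]

def tau (k : ℕ) (μ : ℂ) : A2 ≃ₐ[ℂ] A2 :=
  AlgEquiv.ofAlgHom (aeval ![X 0, X 1 + C μ * X 0 ^ k]) (aeval ![X 0, X 1 + C (-μ) * X 0 ^ k])
    (by ext i; fin_cases i <;> simp)
    (by ext i; fin_cases i <;> simp)

lemma tau_X0 (k : ℕ) (μ : ℂ) : tau k μ (X 0) = X 0 := by simp [tau]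
lemma tau_X1 (k : ℕ) (μ : ℂ) : tau k μ (X 1) = X 1 + C μ * X 0 ^ k := by simp [tau]

lemma tau_inW {k : ℕ} {μ : ℂ} {S : Set ℤ} {h : A2} (hh : InW (1, (k : ℤ)) S h) :
    InW (1, (k : ℤ)) S (tau k μ h) := by
  rw [h.as_sum, map_sum]
  apply InW.sum
  intro m hm
  rw [mem_support_iff] at hm
  have h1 := hh m hm
  rw [mono_eq, map_mul, map_mul, map_pow, map_pow, tau_X0, tau_X1]
  have e : tau k μ (C (coeff m h)) = C (coeff m h) := by
    simpa [MvPolynomial.algebraMap_eq] using (tau k μ).commutes (coeff m h)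
  rw [e]
  have a1 : InW (1, (k:ℤ)) {(k:ℤ)} (X 1 + C μ * X 0 ^ k : A2) := by
    refine InW.add InW.X1 ?_
    refine InW.mul (InW.C μ) (InW.pow InW.X0 k) ?_
    simp
  refine InW.mul (InW.C _) (InW.mul (U := {wt (1, (k:ℤ)) m}) (InW.pow InW.X0 (m 0)) (a1.pow (m 1)) ?_) ?_
  · simp [wt]; ring
  · simpa using h1

def swA : A2 ≃ₐ[ℂ] A2 := renameEquiv ℂ (Equiv.swap 0 1)

def ev (P : A2) (z : ℂ × ℂ) : ℂ := eval ![z.1, z.2] P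

lemma ev_tau (k : ℕ) (μ : ℂ) (P : A2) (z : ℂ × ℂ) :
    ev (tau k μ P) z = ev P (z.1, z.2 + μ * z.1 ^ k) := by
  have : (aeval ![z.1, z.2] : A2 →ₐ[ℂ] ℂ).comp (tau k μ).toAlgHom =
      aeval ![z.1, z.2 + μ * z.1 ^ k] := by
    ext i; fin_cases i <;> simp [tau]
  exact congrArg (fun g : A2 →ₐ[ℂ] ℂ => g P) this

lemma ev_sw (P : A2) (z : ℂ × ℂ) : ev (swA P) z = ev P (z.2, z.1) := by
  have : (aeval ![z.1, z.2] : A2 →ₐ[ℂ] ℂ).comp swA.toAlgHom =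
      aeval ![z.2, z.1] := by
    ext i; fin_cases i <;> simp [swA]
  exact congrArg (fun g : A2 →ₐ[ℂ] ℂ => g P) this

lemma coeff_sw (P : A2) (m : Fin 2 →₀ ℕ) (h : coeff m (swA P) ≠ 0) :
    ∃ n, coeff n P ≠ 0 ∧ n 0 = m 1 ∧ n 1 = m 0 := by
  obtain ⟨n, hn, hn2⟩ := coeff_rename_ne_zero (Equiv.swap 0 1) P m h
  refine ⟨n, hn2, ?_, ?_⟩
  · rw [← hn]
    have := Finsupp.mapDomain_apply (Equiv.swap (0 : Fin 2) 1).injective n 0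
    simp
  · rw [← hn]
    have := Finsupp.mapDomain_apply (Equiv.swap (0 : Fin 2) 1).injective n 1
    simp

/-- a binomial factor -/
lemma binom_factor {w1 w2 n : ℕ} (h1 : 0 < w1) (hc : Nat.Coprime w1 w2) {T : A2}
    (hT : InW ((w1 : ℤ), (w2 : ℤ)) {(w1 * n : ℤ)} T) (hex : ∃ m, coeff m T ≠ 0 ∧ 0 < m 1) :
    ∃ μ : ℂ, (X 1 ^ w1 - C μ * X 0 ^ w2 : A2) ∣ T ∧
      (coeff (Finsupp.single 0 n) T ≠ 0 → μ ≠ 0) := by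
  classical
  have hm : ∀ m, coeff m T ≠ 0 → ∃ j, m 1 = w1 * j ∧ m 0 + w2 * j = n := by
    intro m hm
    have h := hT m hm
    simp only [wt, Set.mem_singleton_iff] at h
    norm_cast at h
    have d1 : w1 ∣ w2 * m 1 := by
      have : w1 ∣ w1 * m 0 + w2 * m 1 := by rw [h]; exact dvd_mul_right _ _
      exact (Nat.dvd_add_right (dvd_mul_right _ _)).mp this
    obtain ⟨j, hj⟩ := hc.dvd_of_dvd_mul_left d1
    refine ⟨j, hj, ?_⟩
    rw [hj] at h
    apply Nat.eq_of_mul_eq_mul_left h1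
    rw [← h]; ring
  let q : Polynomial ℂ := ∑ m ∈ T.support, Polynomial.monomial (m 1 / w1) (coeff m T)
  have hq : ∀ m, coeff m T ≠ 0 → q.coeff (m 1 / w1) = coeff m T := by
    intro m hmT
    simp only [q, Polynomial.finsetSum_coeff, Polynomial.coeff_monomial]
    rw [Finset.sum_eq_single m]
    · simp
    · intro b hb hbm
      rw [if_neg]
      intro hbe
      apply hbm
      rw [mem_support_iff] at hb
      obtain ⟨j, e1, e2⟩ := hm b hb
      obtain ⟨j', e1', e2'⟩ := hm m hmT
      rw [e1, e1', Nat.mul_div_cancel_left _ h1, Nat.mul_div_cancel_left _ h1] at hbe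
      subst hbe
      ext i
      fin_cases i
      · simp only [Fin.zero_eta]; omega
      · simp only [Fin.mk_one]; omega
    · intro hb
      simp only [mem_support_iff, not_not] at hb
      exact absurd hb hmT
  obtain ⟨m0, hm0, hpos⟩ := hex
  have hdeg : q.degree ≠ 0 := by
    intro hd
    obtain ⟨j, e1, e2⟩ := hm m0 hm0
    have h2 := hq m0 hm0
    have : q.coeff (m0 1 / w1) = 0 := by
      apply Polynomial.coeff_eq_zero_of_degree_lt
      rw [hd, e1, Nat.mul_div_cancel_left _ h1]
      have : 0 < j := by
        rcases Nat.eq_zero_or_pos j with rfl | h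
        · simp at e1; omega
        · exact h
      exact_mod_cast this
    rw [this] at h2
    exact hm0 h2.symm
  obtain ⟨μ, hμ⟩ := IsAlgClosed.exists_root q hdeg
  refine ⟨μ, ?_, ?_⟩
  · have key : ∀ m ∈ T.support, (X 1 ^ w1 - C μ * X 0 ^ w2 : A2) ∣
        monomial m (coeff m T) - C (coeff m T * μ ^ (m 1 / w1)) * X 0 ^ n := by
      intro m hmT
      rw [mem_support_iff] at hmT
      obtain ⟨j, e1, e2⟩ := hm m hmT
      rw [e1, Nat.mul_div_cancel_left _ h1, mono_eq, e1, ← e2]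
      have : (C (coeff m T) * (X 0 ^ m 0 * X 1 ^ (w1 * j)) -
          C (coeff m T * μ ^ j) * X 0 ^ (m 0 + w2 * j) : A2) =
          C (coeff m T) * X 0 ^ m 0 * ((X 1 ^ w1) ^ j - (C μ * X 0 ^ w2) ^ j) := by
        rw [C_mul, C_pow]; ring
      rw [this]
      exact Dvd.dvd.mul_left (sub_dvd_pow_sub_pow _ _ _) _
    have h3 := Finset.dvd_sum key
    rw [Finset.sum_sub_distrib, ← T.as_sum, ← Finset.sum_mul, ← map_sum] at h3
    have : ∑ m ∈ T.support, coeff m T * μ ^ (m 1 / w1) = 0 := by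
      have := hμ
      rw [Polynomial.IsRoot, Polynomial.eval_finsetSum] at this
      simpa [Polynomial.eval_monomial] using this
    rw [this] at h3
    simpa using h3
  · rintro hc0 rfl
    have := hq _ hc0
    simp only [ne_eq, zero_ne_one, not_false_eq_true, Finsupp.single_apply, if_false, Nat.zero_div] at this
    rw [Polynomial.IsRoot, ← Polynomial.coeff_zero_eq_eval_zero, this] at hμ
    exact hc0 hμ

/-- straightening a factor `y - μ x^k` -/
lemma straighten {k : ℕ} {μ : ℂ} {T : A2} (hT0 : T ≠ 0) (hT : Good T)
    (hd : (X 1 - C μ * X 0 ^ k : A2) ∣ T) (m : Fin 2 →₀ ℕ) (hm : coeff m (tau k μ T) ≠ 0) :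
    m 0 = 0 := by
  obtain ⟨D, hD0, hD, hDT⟩ := hT.map (tau k μ)
  have h0 : tau k μ T ≠ 0 := by simpa using hT0
  have h1 : tau k μ (X 1 - C μ * X 0 ^ k) = X 1 := by
    rw [map_sub, map_mul, map_pow, tau_X0, tau_X1, ← MvPolynomial.algebraMap_eq, AlgEquiv.commutes]
    ring
  have h2 : (X 1 : A2) ∣ tau k μ T := by
    rw [← h1]; exact map_dvd (tau k μ) hd
  have h3 := hD.ker_factor h0 hDT h2
  have h4 : D (X 0) ≠ 0 := by
    intro h4
    apply hD0
    ext1 i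
    fin_cases i
    · simpa using h4
    · simpa using h3
  rw [der_eq, h3, mul_zero, add_zero] at hDT
  have h5 := (mul_eq_zero.mp hDT).resolve_right h4
  by_contra hne
  have h6 := congrArg (coeff (m - Finsupp.single 0 1)) h5
  rw [coeff_pderiv, coeff_zero] at h6
  have h7 : m - Finsupp.single 0 1 + Finsupp.single 0 1 = m := by
    apply tsub_add_cancel_of_le
    simp; omega
  rw [h7] at h6
  rcases mul_eq_zero.mp h6 with h8 | h8
  · exact hm h8
  · norm_cast at h8

lemma tau_supp {k : ℕ} {μ : ℂ} {P : A2} {d : ℤ} (hP : Good P) (hk : 0 < k)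
    (hd : InW (1, (k:ℤ)) (Iic d) P) (h0 : tp (1, (k:ℤ)) d P ≠ 0)
    (hdv : (X 1 - C μ * X 0 ^ k : A2) ∣ tp (1, (k:ℤ)) d P) (m : Fin 2 →₀ ℕ)
    (hm : coeff m (tau k μ P) ≠ 0) :
    (m 0 + k * m 1 : ℤ) < d ∨ ((m 0 + k * m 1 : ℤ) = d ∧ m 0 = 0) := by
  have hg : Good (tp (1, (k:ℤ)) d P) := hP.tp (by simp) (by simpa using hk) hd
  have hl := lead_tp hd
  by_cases h1 : coeff m (tau k μ (tp (1, (k:ℤ)) d P)) = 0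
  · left
    have := tau_inW (μ := μ) hl.2 m (by rw [map_sub, coeff_sub, h1, sub_zero]; exact hm)
    simp only [wt, one_mul, Set.mem_Iic] at this
    omega
  · right
    have := tau_inW (μ := μ) hl.1 m h1
    simp only [wt, one_mul, Set.mem_singleton_iff] at this
    exact ⟨this, straighten h0 hg hdv m h1⟩

/-- no binomial factor with both exponents at least two -/
lemma no_binom {w1 w2 : ℕ} {μ : ℂ} {T : A2} (hT0 : T ≠ 0) (hT : Good T) (h1 : 2 ≤ w1)
    (h2 : 2 ≤ w2) (hμ : μ ≠ 0) : ¬ (X 1 ^ w1 - C μ * X 0 ^ w2 : A2) ∣ T := by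
  intro hd
  obtain ⟨D, hD0, hD, hDT⟩ := hT
  have h3 := hD.ker_factor hT0 hDT hd
  rw [map_sub, Derivation.leibniz_pow, Derivation.leibniz, Derivation.leibniz_pow,
    derivation_C, smul_zero, add_zero] at h3
  simp only [nsmul_eq_mul, smul_eq_mul] at h3
  have nw1 : (w1 : A2) ≠ 0 := by exact_mod_cast (by omega : w1 ≠ 0)
  have nw2 : (w2 : A2) ≠ 0 := by exact_mod_cast (by omega : w2 ≠ 0)
  have nμ : (C μ : A2) ≠ 0 := by simpa using hμ
  have u1 : IsUnit (w1 : A2) := by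
    have : IsUnit (C (w1 : ℂ) : A2) := (IsUnit.mk0 (w1:ℂ) (by exact_mod_cast (by omega : w1 ≠ 0))).map C
    simpa using this
  have u2 : IsUnit (C μ * (w2 : A2)) := by
    have : IsUnit (C (μ * w2 : ℂ) : A2) := (IsUnit.mk0 _ (mul_ne_zero hμ (by exact_mod_cast (by omega : w2 ≠ 0)))).map C
    simpa using this
  have e : (w1 : A2) * (X 1 ^ (w1 - 1) * D (X 1)) = (C μ * (w2 : A2)) * (X 0 ^ (w2 - 1) * D (X 0)) := by
    linear_combination h3
  have n01 : ¬ (X 1 : A2) ∣ X 0 := by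
    rw [X_dvd_X]; simp
  have n10 : ¬ (X 0 : A2) ∣ X 1 := by
    rw [X_dvd_X]; simp
  have p0 : Prime (X 0 : A2) := X_prime
  have p1 : Prime (X 1 : A2) := X_prime
  have d1 : (X 1 : A2) ∣ D (X 0) := by
    have : (X 1 : A2) ∣ (C μ * (w2 : A2)) * (X 0 ^ (w2 - 1) * D (X 0)) := by
      rw [← e]
      exact ((dvd_pow_self _ (by omega)).mul_right _).mul_left _
    rw [u2.dvd_mul_left] at this
    exact (p1.dvd_or_dvd this).resolve_left fun h => n01 (p1.dvd_of_dvd_pow h)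
  have d0 : (X 0 : A2) ∣ D (X 1) := by
    have : (X 0 : A2) ∣ (w1 : A2) * (X 1 ^ (w1 - 1) * D (X 1)) := by
      rw [e]
      exact ((dvd_pow_self _ (by omega)).mul_right _).mul_left _
    rw [u1.dvd_mul_left] at this
    exact (p0.dvd_or_dvd this).resolve_left fun h => n10 (p0.dvd_of_dvd_pow h)
  have hz : D (X 0) = 0 ∧ D (X 1) = 0 := by
    rcases hD.cross d1 d0 with h | h
    · refine ⟨h, ?_⟩
      rw [h, mul_zero, mul_zero] at e
      simpa [nw1, X_ne_zero] using e
    · refine ⟨?_, h⟩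
      rw [h, mul_zero, mul_zero] at e
      have := e.symm
      simpa [nw2, hμ, X_ne_zero] using this
  apply hD0
  ext1 i
  fin_cases i
  · simpa using hz.1
  · simpa using hz.2

end AuxC

section AuxD
open MvPolynomial
abbrev HH : Type := (ℂ × ℂ) ≃ₜ (ℂ × ℂ)

def IsE (h : HH) : Prop := ∃ (a b c : ℂ) (p : Polynomial ℂ), a ≠ 0 ∧ c ≠ 0 ∧
  ∀ x y, h (x, y) = (a * x + b, c * y + p.eval x)

def sw : HH := Homeomorph.prodComm ℂ ℂ

lemma sw_apply (x y : ℂ) : sw (x, y) = (y, x) := rfl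

def Tame : Subgroup HH := Subgroup.closure ({h | IsE h} ∪ {sw})

def mkE (a b c : ℂ) (p : Polynomial ℂ) (ha : a ≠ 0) (hc : c ≠ 0) : HH where
  toFun z := (a * z.1 + b, c * z.2 + p.eval z.1)
  invFun z := ((z.1 - b) / a, (z.2 - p.eval ((z.1 - b) / a)) / c)
  left_inv z := by
    ext
    · simp [ha]
    · simp [ha, hc]
  right_inv z := by
    ext
    · simp; field_simp; ring
    · simp; field_simp; ring
  continuous_toFun := by
    have := p.continuous
    fun_prop
  continuous_invFun := by
    have := p.continuous
    fun_prop

lemma mkE_isE {a b c : ℂ} {p : Polynomial ℂ} (ha : a ≠ 0) (hc : c ≠ 0) :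
    IsE (mkE a b c p ha hc) := ⟨a, b, c, p, ha, hc, fun _ _ => rfl⟩

def tauH (k : ℕ) (μ : ℂ) : HH :=
  mkE 1 0 1 (Polynomial.C μ * Polynomial.X ^ k) one_ne_zero one_ne_zero

lemma tauH_apply (k : ℕ) (μ : ℂ) (z : ℂ × ℂ) : tauH k μ z = (z.1, z.2 + μ * z.1 ^ k) := by
  simp [tauH, mkE]

def PolyH (φ : HH) : Prop := ∀ Q : A2, ∃ Q' : A2, ∀ z, ev Q (φ z) = ev Q' z

def Reduces (P : A2) : Prop := ∃ φ ∈ Tame, PolyH φ ∧ ∃ p : Polynomial ℂ,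
  ∀ z, ev P (φ z) = p.eval z.1

lemma Reduces.tau {k : ℕ} {μ : ℂ} {P : A2} (h : Reduces (tau k μ P)) : Reduces P := by
  obtain ⟨φ, h1, h2, h3⟩ := h
  refine ⟨tauH k μ * φ, Tame.mul_mem (Subgroup.subset_closure (Or.inl (mkE_isE _ _))) h1, ?_, ?_⟩
  · intro Q
    obtain ⟨Q', hQ'⟩ := h2 (_root_.tau k μ Q)
    refine ⟨Q', fun z => ?_⟩
    rw [← hQ', ev_tau, Homeomorph.mul_apply, tauH_apply]
  · obtain ⟨p, hp⟩ := h3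
    refine ⟨p, fun z => ?_⟩
    rw [← hp, ev_tau, Homeomorph.mul_apply, tauH_apply]

lemma Reduces.sw {P : A2} (h : Reduces (swA P)) : Reduces P := by
  obtain ⟨φ, h1, h2, h3⟩ := h
  refine ⟨_root_.sw * φ, Tame.mul_mem (Subgroup.subset_closure (Or.inr rfl)) h1, ?_, ?_⟩
  · intro Q
    obtain ⟨Q', hQ'⟩ := h2 (swA Q)
    refine ⟨Q', fun z => ?_⟩
    rw [← hQ', ev_sw]; rfl
  · obtain ⟨p, hp⟩ := h3
    refine ⟨p, fun z => ?_⟩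
    rw [← hp, ev_sw]; rfl

lemma reduces_base {P : A2} (h : ∀ m, coeff m P ≠ 0 → m 1 = 0) : Reduces P := by
  refine ⟨1, Tame.one_mem, fun Q => ⟨Q, fun z => rfl⟩, ?_⟩
  refine ⟨aeval ![Polynomial.X, 0] P, fun z => ?_⟩
  have e1 : ∀ z, ev P z = ∑ m ∈ P.support, coeff m P * (z.1 ^ m 0 * z.2 ^ m 1) := by
    intro z
    rw [ev, MvPolynomial.eval_eq']
    simp [Fin.prod_univ_two]
  have e2 : (aeval ![Polynomial.X, 0] P : Polynomial ℂ).eval (z.1) = ev P (z.1, 0) := by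
    have : ((Polynomial.aeval z.1 : Polynomial ℂ →ₐ[ℂ] ℂ).comp
        (aeval ![Polynomial.X, 0] : A2 →ₐ[ℂ] Polynomial ℂ)) = aeval ![z.1, 0] := by
      ext i; fin_cases i <;> simp
    have := congrArg (fun g : A2 →ₐ[ℂ] ℂ => g P) this
    simpa [ev, Polynomial.aeval_def] using this
  rw [e2, e1, e1]
  apply Finset.sum_congr rfl
  intro m hm
  rw [mem_support_iff] at hm
  have := h m hm
  simp [this]

lemma reduce_main : ∀ (n : ℕ) (P : A2), Good P → (∀ m, coeff m P ≠ 0 → m 0 + m 1 ≤ n) →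
    Reduces P := by
  intro n
  induction n with
  | zero =>
    intro P _ h
    exact reduces_base fun m hm => by have := h m hm; omega
  | succ n ih =>
    -- second step
    have step2 : ∀ P : A2, Good P →
        (∀ m, coeff m P ≠ 0 → m 0 + m 1 < n + 1 ∨ (m 0 + m 1 = n + 1 ∧ m 1 = 0)) → Reduces P := by
      intro P hP hs
      by_cases hbase : ∀ m, coeff m P ≠ 0 → m 1 = 0
      · exact reduces_base hbase
      push Not at hbase
      by_cases htop : coeff (Finsupp.single 0 (n+1)) P = 0
      · apply ih P hP
        intro m hm
        rcases hs m hm with h | ⟨h, h'⟩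
        · omega
        · exfalso
          apply hm
          rw [← htop]
          congr 1
          ext i
          fin_cases i
          · simp; omega
          · simp [h']
      -- choose the slope
      let S := P.support.filter (fun m => 0 < m 1)
      have hS : S.Nonempty := by
        obtain ⟨m, h1, h2⟩ := hbase
        exact ⟨m, by simp [S, h1]; omega⟩
      obtain ⟨M, hM, hmin⟩ := S.exists_min_image
        (fun m => (((n + 1 : ℕ) : ℚ) - m 0) / m 1) hS
      simp only [S, Finset.mem_filter, mem_support_iff] at hM hmin
      obtain ⟨hM1, hM2⟩ := hM
      have hM3 : M 1 < n + 1 - M 0 ∧ M 0 < n + 1 := by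
        rcases hs M hM1 with h | h <;> omega
      obtain ⟨g, w1, w2, hg, hcop, e1, e2⟩ := Nat.exists_coprime' (m := M 1) (n := n + 1 - M 0)
        (Nat.gcd_pos_of_pos_left _ hM2)
      have hw1 : 0 < w1 := by
        rcases Nat.eq_zero_or_pos w1 with rfl | h
        · omega
        · exact h
      have hw12 : w1 < w2 := by
        by_contra! hc
        have := Nat.mul_le_mul_right g hc
        omega
      have hle : ∀ m, coeff m P ≠ 0 → w1 * m 0 + w2 * m 1 ≤ w1 * (n + 1) := by
        intro m hm
        rcases Nat.eq_zero_or_pos (m 1) with h0 | h0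
        · rw [h0, mul_zero, add_zero]
          apply Nat.mul_le_mul_left
          rcases hs m hm with h | h <;> omega
        · have h1 := hmin m ⟨hm, h0⟩
          rw [div_le_div_iff₀ (by exact_mod_cast hM2) (by exact_mod_cast h0)] at h1
          have h2 : ((n + 1 : ℕ) : ℚ) - M 0 = (w2 * g : ℕ) := by
            rw [← e2, Nat.cast_sub hM3.2.le]
          rw [h2, e1] at h1
          have h3 : (w2 * m 1 : ℚ) * g ≤ ((n + 1 : ℕ) - m 0) * w1 * g := by
            push_cast at h1 ⊢
            linarith
          have h4 : (0 : ℚ) < g := by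
            exact_mod_cast hg
          have h5 := le_of_mul_le_mul_right h3 h4
          have h6 : (w1 * m 0 + w2 * m 1 : ℚ) ≤ w1 * (n + 1 : ℕ) := by linarith
          exact_mod_cast h6
      have hMeq : w1 * M 0 + w2 * M 1 = w1 * (n + 1) := by
        have : n + 1 = M 0 + w2 * g := by omega
        rw [this, e1]; ring
      have hin : InW ((w1 : ℤ), (w2 : ℤ)) (Iic (w1 * (n + 1 : ℕ) : ℤ)) P := by
        intro m hm
        have := hle m hm
        simp only [wt, Set.mem_Iic]
        exact_mod_cast this
      have hTg : Good (tp ((w1 : ℤ), (w2 : ℤ)) (w1 * (n + 1 : ℕ) : ℤ) P) :=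
        hP.tp (by simpa using hw1) (by simp; omega) hin
      have cM : coeff M (tp ((w1 : ℤ), (w2 : ℤ)) (w1 * (n + 1 : ℕ) : ℤ) P) ≠ 0 := by
        rw [coeff_tp, if_pos]
        · exact hM1
        · simp only [wt]; exact_mod_cast hMeq
      have cT : coeff (Finsupp.single 0 (n+1))
          (tp ((w1 : ℤ), (w2 : ℤ)) (w1 * (n + 1 : ℕ) : ℤ) P) ≠ 0 := by
        rw [coeff_tp, if_pos]
        · exact htop
        · simp [wt]
      have hT0 : tp ((w1 : ℤ), (w2 : ℤ)) (w1 * (n + 1 : ℕ) : ℤ) P ≠ 0 := by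
        intro h; rw [h] at cM; simp at cM
      obtain ⟨μ, hdv, hμ⟩ := binom_factor hw1 hcop (tp_hom _ P) ⟨M, cM, hM2⟩
      have hμ0 := hμ cT
      have hw1' : w1 = 1 := by
        by_contra hne
        exact no_binom hT0 hTg (by omega) (by omega) hμ0 hdv
      subst hw1'
      simp only [Nat.cast_one, one_mul, pow_one] at hdv hT0 hin
      apply Reduces.tau (k := w2) (μ := μ)
      apply ih _ (hP.map _)
      intro m hm
      have hk := tau_supp hP (by omega) hin hT0 hdv m hm
      have hk2 : m 0 + w2 * m 1 < n + 1 ∨ (m 0 + w2 * m 1 = n + 1 ∧ m 0 = 0) := by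
        exact_mod_cast hk
      rcases hk2 with h | ⟨h, h'⟩
      · nlinarith
      · rw [h', zero_add] at h ⊢
        have : 0 < m 1 := by
          rcases Nat.eq_zero_or_pos (m 1) with h0 | h0
          · rw [h0] at h; omega
          · exact h0
        nlinarith
    intro P hP hs
    by_cases hlin : ∃ m, coeff m P ≠ 0 ∧ m 0 + m 1 = n + 1 ∧ 0 < m 1
    · obtain ⟨M, hM, hM1, hM2⟩ := hlin
      have hin : InW (((1:ℕ) : ℤ), ((1:ℕ) : ℤ)) (Iic ((1:ℕ) * (n + 1 : ℕ) : ℤ)) P := by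
        intro m hm
        have := hs m hm
        simp only [wt, Set.mem_Iic]
        push_cast; omega
      have cM : coeff M (tp (((1:ℕ) : ℤ), ((1:ℕ) : ℤ)) ((1:ℕ) * (n + 1 : ℕ) : ℤ) P) ≠ 0 := by
        rw [coeff_tp, if_pos]
        · exact hM
        · simp only [wt]; push_cast; omega
      have hT0 : tp (((1:ℕ) : ℤ), ((1:ℕ) : ℤ)) ((1:ℕ) * (n + 1 : ℕ) : ℤ) P ≠ 0 := by
        intro h; rw [h] at cM; simp at cM
      obtain ⟨μ, hdv, -⟩ := binom_factor one_pos (Nat.coprime_one_left 1) (tp_hom _ P) ⟨M, cM, hM2⟩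
      apply Reduces.tau (k := 1) (μ := μ)
      apply Reduces.sw
      apply step2 _ ((hP.map _).map _)
      intro m hm
      obtain ⟨m', hm', hh0, hh1⟩ := coeff_sw _ m hm
      have hk := tau_supp (k := 1) hP one_pos hin hT0 (by simpa using hdv) m' hm'
      push_cast at hk
      omega
    · push Not at hlin
      apply step2 P hP
      intro m hm
      have := hs m hm
      have := hlin m hm
      omega

end AuxD

section AuxE
open MvPolynomial
lemma poly_surj {q : Polynomial ℂ} (hq : Function.Injective fun y => q.eval y) (c : ℂ) :
    ∃ y, q.eval y = c := by
  have hd : (q - Polynomial.C c).degree ≠ 0 := by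
    intro hd
    have h1 := Polynomial.eq_C_of_degree_eq_zero hd
    have h2 : q.eval 0 = q.eval 1 := by
      have e0 := congrArg (Polynomial.eval 0) h1
      have e1 := congrArg (Polynomial.eval 1) h1
      simp only [Polynomial.eval_sub, Polynomial.eval_C] at e0 e1
      linear_combination e0 - e1
    exact zero_ne_one (hq h2)
  obtain ⟨y, hy⟩ := IsAlgClosed.exists_root _ hd
  refine ⟨y, ?_⟩
  simpa [Polynomial.IsRoot, sub_eq_zero] using hy

lemma poly_inj_linear {q : Polynomial ℂ} (hq : Function.Injective fun y => q.eval y) :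
    ∃ a b : ℂ, a ≠ 0 ∧ ∀ y, q.eval y = a * y + b := by
  -- only root of q - q(0) is 0
  set r := q - Polynomial.C (q.eval 0) with hr
  have hroot : ∀ z ∈ r.roots, z = 0 := by
    intro z hz
    have := Polynomial.isRoot_of_mem_roots hz
    apply hq
    simpa [hr, Polynomial.IsRoot, sub_eq_zero] using this
  have hsplit : r.Splits := IsAlgClosed.splits r
  have h1 : r = Polynomial.C r.leadingCoeff * Polynomial.X ^ (Multiset.card r.roots) := by
    have h2 := hsplit.eq_prod_roots
    rw [Multiset.eq_replicate_card.mpr hroot] at h2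
    simpa using h2
  set n := Multiset.card r.roots
  set c := r.leadingCoeff
  have h3 : ∀ y, q.eval y = c * y ^ n + q.eval 0 := by
    intro y
    have := congrArg (Polynomial.eval y) h1
    simp [hr] at this
    linear_combination this
  have hc : c ≠ 0 := by
    intro hc
    have : q.eval 0 = q.eval 1 := by rw [h3 0, h3 1, hc]; ring
    exact zero_ne_one (hq this)
  have hn : n = 1 := by
    by_contra hn
    rcases Nat.eq_zero_or_pos n with h0 | h0
    · have : q.eval 0 = q.eval 1 := by rw [h3 0, h3 1, h0]; simp
      exact zero_ne_one (hq this)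
    · have hp := Complex.isPrimitiveRoot_exp n h0.ne'
      have h4 : q.eval (Complex.exp (2 * Real.pi * Complex.I / n)) = q.eval 1 := by
        rw [h3 1, h3 (Complex.exp _), hp.pow_eq_one]; simp
      exact hp.ne_one (by omega) (hq h4)
  refine ⟨c, q.eval 0, hc, fun y => ?_⟩
  rw [h3 y, hn, pow_one]

lemma poly_nonvanish {q : Polynomial ℂ} (h : ∀ x, q.eval x ≠ 0) : ∃ c, c ≠ 0 ∧ ∀ x, q.eval x = c := by
  have hd : q.degree = 0 := by
    by_contra hd
    obtain ⟨y, hy⟩ := IsAlgClosed.exists_root _ hd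
    exact h y hy
  have h1 := Polynomial.eq_C_of_degree_eq_zero hd
  refine ⟨q.coeff 0, ?_, fun x => ?_⟩
  · have := h 0
    rw [h1] at this
    simpa using this
  · rw [h1]; simp

lemma ev_left (Q : A2) (x : ℂ) : ∃ q : Polynomial ℂ, ∀ y, q.eval y = ev Q (x, y) := by
  refine ⟨aeval ![Polynomial.C x, Polynomial.X] Q, fun y => ?_⟩
  have : ((Polynomial.aeval y : Polynomial ℂ →ₐ[ℂ] ℂ).comp
      (aeval ![Polynomial.C x, Polynomial.X] : A2 →ₐ[ℂ] Polynomial ℂ)) = aeval ![x, y] := by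
    ext i; fin_cases i <;> simp
  have := congrArg (fun g : A2 →ₐ[ℂ] ℂ => g Q) this
  simpa [ev, Polynomial.aeval_def] using this

lemma ev_right (Q : A2) (y : ℂ) : ∃ q : Polynomial ℂ, ∀ x, q.eval x = ev Q (x, y) := by
  refine ⟨aeval ![Polynomial.X, Polynomial.C y] Q, fun x => ?_⟩
  have : ((Polynomial.aeval x : Polynomial ℂ →ₐ[ℂ] ℂ).comp
      (aeval ![Polynomial.X, Polynomial.C y] : A2 →ₐ[ℂ] Polynomial ℂ)) = aeval ![x, y] := by
    ext i; fin_cases i <;> simp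
  have := congrArg (fun g : A2 →ₐ[ℂ] ℂ => g Q) this
  simpa [ev, Polynomial.aeval_def] using this

lemma isE_of_triangular {h : HH} {p : Polynomial ℂ} {Q : A2}
    (hh : ∀ z, h z = (p.eval z.1, ev Q z)) : IsE h := by
  have hinj : ∀ x, Function.Injective fun y => ev Q (x, y) := by
    intro x y1 y2 hy
    have : h (x, y1) = h (x, y2) := by rw [hh, hh]; simpa using hy
    simpa using h.injective this
  have hlin : ∀ x, ∃ a b : ℂ, a ≠ 0 ∧ ∀ y, ev Q (x, y) = a * y + b := by
    intro x
    obtain ⟨q, hq⟩ := ev_left Q x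
    simp only [← hq]
    apply poly_inj_linear
    simp only [hq]; exact hinj x
  have hp : Function.Injective fun x => p.eval x := by
    intro x1 x2 hx
    obtain ⟨q, hq⟩ := ev_left Q x2
    obtain ⟨y, hy⟩ := poly_surj (q := q) (by simp only [hq]; exact hinj x2) (ev Q (x1, 0))
    have : h (x1, 0) = h (x2, y) := by
      rw [hh, hh]
      simp only at hx
      simp only [hx, ← hq, hy]
    have := h.injective this
    exact congrArg Prod.fst this
  obtain ⟨a, b, ha, hab⟩ := poly_inj_linear hp
  obtain ⟨q0, hq0⟩ := ev_right Q 0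
  obtain ⟨q1, hq1⟩ := ev_right Q 1
  obtain ⟨c, hc, hcc⟩ := poly_nonvanish (q := q1 - q0) (by
    intro x
    obtain ⟨α, β, hα, hαβ⟩ := hlin x
    rw [Polynomial.eval_sub, hq0, hq1, hαβ, hαβ]
    simpa using hα)
  refine ⟨a, b, c, q0, ha, hc, fun x y => ?_⟩
  rw [hh]
  simp only [hab]
  congr 1
  obtain ⟨α, β, hα, hαβ⟩ := hlin x
  have h1 := hcc x
  rw [Polynomial.eval_sub, hq0, hq1, hαβ, hαβ] at h1
  rw [hq0, hαβ, hαβ]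
  linear_combination y * h1

lemma ev_aeval (R P Q : A2) (z : ℂ × ℂ) :
    ev (aeval ![P, Q] R) z = ev R (ev P z, ev Q z) := by
  have : (aeval ![z.1, z.2] : A2 →ₐ[ℂ] ℂ).comp (aeval ![P, Q] : A2 →ₐ[ℂ] A2) =
      aeval ![ev P z, ev Q z] := by
    ext i; fin_cases i <;> simp [ev, aeval_eq_eval]
  exact congrArg (fun g : A2 →ₐ[ℂ] ℂ => g R) this

lemma ev_ext {P Q : A2} (h : ∀ z, ev P z = ev Q z) : P = Q := by
  apply MvPolynomial.funext
  intro x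
  have := h (x 0, x 1)
  have e : ![x 0, x 1] = x := by ext i; fin_cases i <;> rfl
  simpa [ev, e] using this

theorem jung {F : HH} {P Q P' Q' : A2} (hF : ∀ z, F z = (ev P z, ev Q z))
    (hF' : ∀ z, F.symm z = (ev P' z, ev Q' z)) : F ∈ Tame := by
  have e0 : ∀ z, ev (X 0) z = z.1 := fun z => by simp [ev]
  have e1 : ∀ z, ev (X 1) z = z.2 := fun z => by simp [ev]
  have hFF : ∀ z, (ev P (ev P' z, ev Q' z), ev Q (ev P' z, ev Q' z)) = z := by
    intro z; rw [← hF', ← hF]; simp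
  have hFF' : ∀ z, (ev P' (ev P z, ev Q z), ev Q' (ev P z, ev Q z)) = z := by
    intro z; rw [← hF, ← hF']; simp
  let Φ : A2 ≃ₐ[ℂ] A2 := AlgEquiv.ofAlgHom (aeval ![P, Q]) (aeval ![P', Q'])
    (by
      ext1 i; apply ev_ext; intro z
      have h := hFF' z
      fin_cases i
      · simp only [AlgHom.comp_apply, aeval_X, AlgHom.id_apply, Fin.zero_eta, Matrix.cons_val_zero, ev_aeval, e0]
        exact congrArg Prod.fst h
      · simp only [AlgHom.comp_apply, aeval_X, AlgHom.id_apply, Fin.mk_one, Matrix.cons_val_one, ev_aeval, e1]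
        exact congrArg Prod.snd h)
    (by
      ext1 i; apply ev_ext; intro z
      have h := hFF z
      fin_cases i
      · simp only [AlgHom.comp_apply, aeval_X, AlgHom.id_apply, Fin.zero_eta, Matrix.cons_val_zero, ev_aeval, e0]
        exact congrArg Prod.fst h
      · simp only [AlgHom.comp_apply, aeval_X, AlgHom.id_apply, Fin.mk_one, Matrix.cons_val_one, ev_aeval, e1]
        exact congrArg Prod.snd h)
  have hgX : Good (X 0) := by
    refine ⟨pderiv 1, ?_, lnd_pderiv_one, by simp [pderiv_X]⟩
    intro h
    have := congrArg (fun D : Der2 => D (X 1)) h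
    simp at this
  have hgP : Good P := by
    have := hgX.map Φ
    simpa [Φ] using this
  obtain ⟨φ, h1, h2, p, hp⟩ := reduce_main P.totalDegree P hgP (by
    intro m hm
    have := MvPolynomial.le_totalDegree (mem_support_iff.mpr hm)
    rw [Finsupp.sum_fintype _ _ (by simp), Fin.sum_univ_two] at this
    exact this)
  obtain ⟨R, hR⟩ := h2 Q
  have h3 : IsE (F * φ) := isE_of_triangular (p := p) (Q := R) (by
    intro z
    rw [Homeomorph.mul_apply, hF, hp, hR])
  have h4 : F * φ ∈ Tame := Subgroup.subset_closure (Or.inl h3)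
  have := Tame.mul_mem h4 (Tame.inv_mem h1)
  simpa using this

end AuxE

section AuxF
open MvPolynomial
lemma mkE_apply (a b c : ℂ) (p : Polynomial ℂ) (ha : a ≠ 0) (hc : c ≠ 0) (x y : ℂ) :
    mkE a b c p ha hc (x, y) = (a * x + b, c * y + p.eval x) := rfl

lemma IsE.one : IsE 1 := ⟨1, 0, 1, 0, one_ne_zero, one_ne_zero, fun x y => by simp⟩

lemma IsE.mul {g h : HH} (hg : IsE g) (hh : IsE h) : IsE (g * h) := by
  obtain ⟨a, b, c, p, ha, hc, e⟩ := hg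
  obtain ⟨a', b', c', p', ha', hc', e'⟩ := hh
  refine ⟨a * a', a * b' + b, c * c',
    Polynomial.C c * p' + p.comp (Polynomial.C a' * Polynomial.X + Polynomial.C b'),
    mul_ne_zero ha ha', mul_ne_zero hc hc', fun x y => ?_⟩
  rw [Homeomorph.mul_apply, e', e]
  ext
  · simp; ring
  · simp [Polynomial.eval_comp]; ring

lemma IsE.inv {g : HH} (hg : IsE g) : IsE g⁻¹ := by
  obtain ⟨a, b, c, p, ha, hc, e⟩ := hg
  refine ⟨a⁻¹, -b / a, c⁻¹,
    Polynomial.C (-c⁻¹) * p.comp (Polynomial.C a⁻¹ * Polynomial.X + Polynomial.C (-b / a)),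
    inv_ne_zero ha, inv_ne_zero hc, fun x y => ?_⟩
  apply g.injective
  have hgi : g (g⁻¹ (x, y)) = (x, y) := by
    rw [← Homeomorph.mul_apply, mul_inv_cancel]; rfl
  rw [hgi, e]
  simp only [Polynomial.eval_mul, Polynomial.eval_comp, Polynomial.eval_add, Polynomial.eval_C,
    Polynomial.eval_X, Homeomorph.one_apply]
  ext
  · simp; field_simp; ring
  · simp; field_simp; ring

lemma sw_mul_sw : sw * sw = 1 := by ext z <;> rfl

def IsAff (h : HH) : Prop := ∃ a b c d e : ℂ, a ≠ 0 ∧ c ≠ 0 ∧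
  ∀ x y, h (x, y) = (a * x + b, c * y + (d * x + e))

def IsNA (h : HH) : Prop := ∃ (a b c : ℂ) (p : Polynomial ℂ), 2 ≤ p.natDegree ∧
  ∀ x y, h (x, y) = (a * x + b, c * y + p.eval x)

lemma IsE.cases {h : HH} (hh : IsE h) : IsAff h ∨ IsNA h := by
  obtain ⟨a, b, c, p, ha, hc, e⟩ := hh
  by_cases hp : 2 ≤ p.natDegree
  · exact Or.inr ⟨a, b, c, p, hp, e⟩
  · left
    have h1 := Polynomial.eq_X_add_C_of_natDegree_le_one (p := p) (by omega)
    refine ⟨a, b, c, p.coeff 1, p.coeff 0, ha, hc, fun x y => ?_⟩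
    rw [e, h1]; simp

lemma bruhat {h : HH} (hh : IsAff h) :
    IsE (sw * h * sw) ∨ ∃ e1 e2, IsE e1 ∧ IsE e2 ∧ sw * h * sw = e1 * sw * e2 := by
  obtain ⟨a, b, c, d, e, ha, hc, hx⟩ := hh
  have key : ∀ x y, (sw * h * sw) (x, y) = (c * x + (d * y + e), a * y + b) := by
    intro x y
    rw [Homeomorph.mul_apply, Homeomorph.mul_apply, sw_apply, hx, sw_apply]
  by_cases hd : d = 0
  · left
    refine ⟨c, e, a, Polynomial.C b, hc, ha, fun x y => ?_⟩
    rw [key, hd]; simp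
  · right
    refine ⟨mkE 1 0 (-(a * c / d)) (Polynomial.C (a / d) * Polynomial.X + Polynomial.C (b - a * e / d))
      one_ne_zero (neg_ne_zero.mpr (div_ne_zero (mul_ne_zero ha hc) hd)),
      mkE 1 0 d (Polynomial.C c * Polynomial.X + Polynomial.C e) one_ne_zero hd,
      mkE_isE _ _, mkE_isE _ _, ?_⟩
    apply Homeomorph.ext
    rintro ⟨x, y⟩
    rw [key, Homeomorph.mul_apply, Homeomorph.mul_apply, mkE_apply, sw_apply, mkE_apply]
    ext
    · simp; ring
    · simp; field_simp; ring

def wprod (L : List HH) : HH := (L.map (fun e => sw * e)).prod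

lemma wprod_append (L M : List HH) : wprod (L ++ M) = wprod L * wprod M := by
  simp [wprod]

lemma wprod_cons (e : HH) (M : List HH) : wprod (e :: M) = sw * e * wprod M := by
  simp [wprod]

lemma tame_word {g : HH} (hg : g ∈ Tame) :
    ∃ e0 L, IsE e0 ∧ (∀ e ∈ L, IsE e) ∧ g = e0 * wprod L := by
  have step : ∀ y : HH, (IsE y ∨ y = sw) → ∀ g : HH,
      (∃ e0 L, IsE e0 ∧ (∀ e ∈ L, IsE e) ∧ g = e0 * wprod L) →
      (∃ e0 L, IsE e0 ∧ (∀ e ∈ L, IsE e) ∧ y * g = e0 * wprod L) := by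
    rintro y hy g ⟨e0, L, h1, h2, rfl⟩
    rcases hy with hy | rfl
    · exact ⟨y * e0, L, hy.mul h1, h2, by rw [mul_assoc]⟩
    · refine ⟨1, e0 :: L, IsE.one, ?_, by rw [wprod_cons, one_mul, mul_assoc]⟩
      intro e he
      rcases List.mem_cons.mp he with rfl | he
      · exact h1
      · exact h2 e he
  induction hg using Subgroup.closure_induction_left with
  | one => exact ⟨1, [], IsE.one, by simp, by simp [wprod]⟩
  | mul_left x hx y hy ih => exact step x hx _ ih
  | inv_mul_cancel x hx y hy ih =>
    apply step _ _ _ ih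
    rcases hx with hx | hx
    · exact Or.inl (IsE.inv hx)
    · right
      rw [Set.mem_singleton_iff.mp hx]
      exact inv_eq_of_mul_eq_one_left sw_mul_sw

def Nice (h : HH) : Prop := IsE h ∨ (∃ e, IsAff e ∧ h = sw * e) ∨
  ∃ L : List HH, L ≠ [] ∧ (∀ e ∈ L, IsNA e) ∧ h = wprod L

lemma isConj_mul_comm' (a b : HH) : IsConj (a * b) (b * a) := by
  rw [isConj_iff]
  exact ⟨b, by group⟩

lemma word_nice : ∀ (n : ℕ) (L : List HH), L.length = n → (∀ e ∈ L, IsE e) → ∀ e0, IsE e0 →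
    ∃ h, Nice h ∧ IsConj (e0 * wprod L) h := by
  intro n
  induction n using Nat.strong_induction_on with
  | _ n ih =>
  -- the case e0 = 1
  have main : ∀ L : List HH, L.length = n → L ≠ [] → (∀ e ∈ L, IsE e) →
      ∃ h, Nice h ∧ IsConj (wprod L) h := by
    intro L hL hne hE
    by_cases hna : ∀ e ∈ L, IsNA e
    · exact ⟨wprod L, Or.inr (Or.inr ⟨L, hne, hna, rfl⟩), IsConj.refl _⟩
    push Not at hna
    obtain ⟨e, heL, heN⟩ := hna
    have hA : IsAff e := (hE e heL).cases.resolve_right heN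
    obtain ⟨L1, L2, rfl⟩ := List.append_of_mem heL
    have hconj : IsConj (wprod (L1 ++ e :: L2)) (sw * e * wprod (L2 ++ L1)) := by
      rw [wprod_append, wprod_cons, wprod_append, ← mul_assoc (sw * e)]
      exact isConj_mul_comm' _ _
    have hM : ∀ x ∈ L2 ++ L1, IsE x := by
      intro x hx
      apply hE
      simp only [List.mem_append, List.mem_cons] at hx ⊢
      tauto
    have hlen : (L2 ++ L1).length + 1 = n := by
      rw [← hL]; simp; omega
    generalize L2 ++ L1 = M at hconj hM hlen
    cases M with
    | nil =>
      refine ⟨sw * e, Or.inr (Or.inl ⟨e, hA, rfl⟩), ?_⟩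
      simpa [wprod] using hconj
    | cons e' M' =>
      simp only [List.length_cons] at hlen
      have he' := hM e' (by simp)
      have hM' : ∀ x ∈ M', IsE x := fun x hx => hM x (by simp [hx])
      rcases bruhat hA with h | ⟨e1, e2, h1, h2, h3⟩
      · obtain ⟨k, hk, hk2⟩ := ih M'.length (by omega) M' rfl hM' (sw * e * sw * e') (h.mul he')
        refine ⟨k, hk, hconj.trans ?_⟩
        rw [wprod_cons]
        convert hk2 using 1
        group
      · obtain ⟨k, hk, hk2⟩ := ih (M'.length + 1) (by omega) ((e2 * e') :: M') (by simp) (by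
          intro x hx
          rcases List.mem_cons.mp hx with rfl | hx
          · exact h2.mul he'
          · exact hM' x hx) e1 h1
        refine ⟨k, hk, hconj.trans ?_⟩
        rw [wprod_cons] at hk2 ⊢
        convert hk2 using 1
        calc sw * e * (sw * e' * wprod M') = (sw * e * sw) * e' * wprod M' := by group
          _ = _ := by rw [h3]; group
  intro L hL hE e0 he0
  rcases List.eq_nil_or_concat L with rfl | ⟨L', e, rfl⟩
  · refine ⟨e0, Or.inl he0, ?_⟩
    simpa [wprod] using IsConj.refl e0
  · rw [List.concat_eq_append] at *
    obtain ⟨h, h1, h2⟩ := main (L' ++ [e * e0]) (by simpa using hL) (by simp) (by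
      intro x hx
      rw [List.mem_append, List.mem_singleton] at hx
      rcases hx with hx | rfl
      · exact hE x (by simp [hx])
      · exact (hE e (by simp)).mul he0)
    refine ⟨h, h1, IsConj.trans ?_ h2⟩
    refine (isConj_mul_comm' _ _).trans ?_
    rw [wprod_append, wprod_append, wprod_cons, wprod_cons]
    simp only [wprod, List.map_nil, List.prod_nil, mul_one, mul_assoc]
    exact IsConj.refl _

lemma tame_nice {g : HH} (hg : g ∈ Tame) : ∃ h, Nice h ∧ IsConj g h := by
  obtain ⟨e0, L, h1, h2, rfl⟩ := tame_word hg
  exact word_nice _ L rfl h2 e0 h1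

end AuxF

section AuxG
open MvPolynomial
lemma aff_not_dense (a b z : ℂ) : ¬ Dense (Set.range fun k : ℕ => (fun x => a * x + b)^[k] z) := by
  -- it suffices to find a closed proper set containing the orbit
  have suff : ∀ S : Set ℂ, IsClosed S → (∀ k : ℕ, (fun x => a * x + b)^[k] z ∈ S) →
      (∃ x, x ∉ S) → ¬ Dense (Set.range fun k : ℕ => (fun x => a * x + b)^[k] z) := by
    rintro S hS h ⟨x, hx⟩ hd
    have : closure (Set.range fun k : ℕ => (fun x => a * x + b)^[k] z) ⊆ S :=
      closure_minimal (by rintro _ ⟨k, rfl⟩; exact h k) hS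
    exact hx (this (hd x))
  by_cases ha : a = 1
  · subst ha
    have hk : ∀ k : ℕ, (fun x => 1 * x + b)^[k] z = z + k * b := by
      intro k
      induction k with
      | zero => simp
      | succ k ih => rw [Function.iterate_succ_apply', ih]; push_cast; ring
    by_cases hb : b = 0
    · refine suff {z} isClosed_singleton (fun k => ?_) ⟨z + 1, by simp⟩
      rw [hk, hb]; simp
    · refine suff {w | ((w - z) / b).im = 0} ?_ (fun k => ?_) ⟨z + Complex.I * b, ?_⟩
      · exact isClosed_eq (by fun_prop) continuous_const
      · rw [hk]; simp [hb]
      · simp [hb]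
  · have ha' : 1 - a ≠ 0 := sub_ne_zero.mpr (Ne.symm ha)
    set c := b / (1 - a) with hc
    have hcb : a * c + b = c := by rw [hc]; field_simp; ring
    have hk : ∀ k : ℕ, (fun x => a * x + b)^[k] z - c = a ^ k * (z - c) := by
      intro k
      induction k with
      | zero => simp
      | succ k ih =>
        rw [Function.iterate_succ_apply']
        linear_combination a * ih + hcb
    by_cases hz : z = c
    · refine suff {c} isClosed_singleton (fun k => ?_) ⟨c + 1, by simp⟩
      have := hk k
      rw [hz, sub_self, mul_zero, sub_eq_zero] at this
      rw [hz]; exact this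
    rcases le_total ‖a‖ 1 with h1 | h1
    · refine suff {w | ‖w - c‖ ≤ ‖z - c‖} (isClosed_le (by fun_prop) continuous_const)
        (fun k => ?_) ⟨c + (‖z - c‖ + 1 : ℝ), ?_⟩
      · rw [Set.mem_setOf_eq, hk, norm_mul, norm_pow]
        exact mul_le_of_le_one_left (norm_nonneg _) (pow_le_one₀ (norm_nonneg _) h1)
      · simp only [Set.mem_setOf_eq, add_sub_cancel_left, Complex.norm_real, not_le]
        rw [Real.norm_of_nonneg (by positivity)]; linarith
    · refine suff {w | ‖z - c‖ ≤ ‖w - c‖} (isClosed_le continuous_const (by fun_prop))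
        (fun k => ?_) ⟨c, ?_⟩
      · rw [Set.mem_setOf_eq, hk, norm_mul, norm_pow]
        exact le_mul_of_one_le_left (norm_nonneg _) (one_le_pow₀ h1)
      · simp [sub_eq_zero, hz]

/-- a continuous surjective semiconjugacy to an affine map excludes dense orbits -/
lemma not_chaotic_of_semiconj {X : Type*} [TopologicalSpace X] {f : X → X} {π : X → ℂ}
    (hc : Continuous π) (hs : Function.Surjective π) {a b : ℂ} (h : ∀ x, π (f x) = a * π x + b) :
    ¬ Chaotic f := by
  rintro ⟨⟨x, hx⟩, -⟩
  apply aff_not_dense a b (π x)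
  have h1 := hs.denseRange.dense_image hc hx
  rw [← Set.range_comp] at h1
  have : (π ∘ fun k : ℕ => f^[k] x) = fun k : ℕ => (fun x => a * x + b)^[k] (π x) := by
    funext k
    have hsc : Function.Semiconj π f (fun x => a * x + b) := h
    exact (hsc.iterate_right k).eq x
  rwa [this] at h1

def Cone (R : ℝ) : Set (ℂ × ℂ) := {z | R < ‖z.1‖ ∧ ‖z.2‖ < ‖z.1‖}

def Exp (h : HH) : Prop := ∃ R0 : ℝ, ∀ R ≥ R0, ∀ z ∈ Cone R, h z ∈ Cone R ∧ ‖z.1‖ < ‖(h z).1‖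

lemma Exp.mul {g h : HH} (hg : Exp g) (hh : Exp h) : Exp (g * h) := by
  obtain ⟨R1, h1⟩ := hg
  obtain ⟨R2, h2⟩ := hh
  refine ⟨max R1 R2, fun R hR z hz => ?_⟩
  have a := h2 R (le_trans (le_max_right _ _) hR) z hz
  have b := h1 R (le_trans (le_max_left _ _) hR) _ a.1
  rw [Homeomorph.mul_apply]
  exact ⟨b.1, a.2.trans b.2⟩

lemma exp_na {e : HH} (he : IsNA e) : Exp (sw * e) := by
  obtain ⟨a, b, c, p, hp, h⟩ := he
  have hdiv : 0 < p.divX.degree := by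
    rw [← Polynomial.natDegree_pos_iff_degree_pos, Polynomial.natDegree_divX_eq_natDegree_tsub_one]
    omega
  have ht : Tendsto (fun x : ℂ => ‖p.divX.eval x‖) (Bornology.cobounded ℂ) atTop :=
    Polynomial.tendsto_norm_atTop _ hdiv tendsto_norm_cobounded_atTop
  have hev := ht.eventually_ge_atTop (‖c‖ + 1 + ‖a‖ + ‖b‖ + ‖p.coeff 0‖ + 1)
  rw [← comap_norm_atTop, Filter.eventually_comap] at hev
  obtain ⟨R0, hR0⟩ := Filter.eventually_atTop.mp hev
  refine ⟨max R0 1, fun R hR z hz => ?_⟩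
  obtain ⟨x, y⟩ := z
  obtain ⟨hz1, hz2⟩ := hz
  simp only at hz1 hz2
  have hx0 : R0 ≤ ‖x‖ := by linarith [le_max_left R0 1]
  have hx1 : 1 ≤ ‖x‖ := by linarith [le_max_right R0 1]
  have hq := hR0 _ hx0 x rfl
  have e1 : (sw * e) (x, y) = (c * y + p.eval x, a * x + b) := by
    rw [Homeomorph.mul_apply, h, sw_apply]
  have e2 : p.eval x = p.divX.eval x * x + p.coeff 0 := by
    conv_lhs => rw [← Polynomial.divX_mul_X_add p]
    simp
  have n1 : ‖p.divX.eval x‖ * ‖x‖ ≤ ‖c * y + p.eval x‖ + ‖c‖ * ‖y‖ + ‖p.coeff 0‖ := by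
    rw [← norm_mul, ← norm_mul]
    have : p.divX.eval x * x = (c * y + p.eval x) - c * y - p.coeff 0 := by rw [e2]; ring
    rw [this]
    exact (norm_sub_le _ _).trans (by gcongr; exact norm_sub_le _ _)
  have n2 : (‖c‖ + 1 + ‖a‖ + ‖b‖ + ‖p.coeff 0‖ + 1) * ‖x‖ ≤ ‖p.divX.eval x‖ * ‖x‖ := by
    gcongr
  have n3 : ‖c‖ * ‖y‖ ≤ ‖c‖ * ‖x‖ := by gcongr
  have n4 : ‖p.coeff 0‖ ≤ ‖p.coeff 0‖ * ‖x‖ := le_mul_of_one_le_right (norm_nonneg _) hx1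
  have n5 : ‖b‖ ≤ ‖b‖ * ‖x‖ := le_mul_of_one_le_right (norm_nonneg _) hx1
  have n6 : ‖a * x + b‖ ≤ ‖a‖ * ‖x‖ + ‖b‖ := by
    rw [← norm_mul]; exact norm_add_le _ _
  have n7 : 0 ≤ ‖a‖ * ‖x‖ := by positivity
  have n8 : 0 ≤ ‖b‖ := norm_nonneg _
  rw [e1]
  have k1 : ‖x‖ < ‖c * y + p.eval x‖ := by nlinarith
  have k2 : ‖a * x + b‖ < ‖c * y + p.eval x‖ := by nlinarith
  exact ⟨⟨hz1.trans k1, k2⟩, k1⟩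

lemma exp_wprod : ∀ L : List HH, L ≠ [] → (∀ e ∈ L, IsNA e) → Exp (wprod L) := by
  intro L
  induction L with
  | nil => intro h; exact absurd rfl h
  | cons e L ih =>
    intro _ h
    rw [wprod_cons]
    have h1 := exp_na (h e (by simp))
    cases L with
    | nil => simpa [wprod] using h1
    | cons e' L' => exact h1.mul (ih (by simp) fun x hx => h x (by simp [hx]))

lemma Exp.not_chaotic {h : HH} (hh : Exp h) : ¬ Chaotic ⇑h := by
  rintro ⟨-, hd⟩
  obtain ⟨R, hR⟩ := hh
  have hR := hR R le_rfl
  have hopen : IsOpen (Cone R) :=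
    IsOpen.and (isOpen_lt (f := fun _ : ℂ × ℂ => R) (g := fun z => ‖z.1‖) continuous_const (by fun_prop))
      (isOpen_lt (f := fun z : ℂ × ℂ => ‖z.2‖) (g := fun z => ‖z.1‖) (by fun_prop) (by fun_prop))
  have hne : (Cone R).Nonempty := by
    refine ⟨((|R| + 1 : ℝ), 0), ?_, ?_⟩
    · simp only [Complex.norm_real]
      rw [Real.norm_of_nonneg (by positivity)]
      linarith [le_abs_self R]
    · simp only [Complex.norm_real, norm_zero]
      rw [Real.norm_of_nonneg (by positivity)]
      positivity
  obtain ⟨z, hz, k, hk, hkz⟩ := hd.inter_open_nonempty _ hopen hne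
  have key : ∀ k : ℕ, (⇑h)^[k] z ∈ Cone R ∧ ‖z.1‖ ≤ ‖((⇑h)^[k] z).1‖ ∧
      (0 < k → ‖z.1‖ < ‖((⇑h)^[k] z).1‖) := by
    intro k
    induction k with
    | zero => exact ⟨hz, le_rfl, fun h => absurd h (lt_irrefl _)⟩
    | succ k ih =>
      rw [Function.iterate_succ_apply']
      have := hR _ ih.1
      have h2 := lt_of_le_of_lt ih.2.1 this.2
      exact ⟨this.1, h2.le, fun _ => h2⟩
  have := (key k).2.2 hk
  rw [hkz] at this
  exact lt_irrefl _ this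

lemma Nice.not_chaotic {h : HH} (hh : Nice h) : ¬ Chaotic ⇑h := by
  rcases hh with ⟨a, b, c, p, ha, hc, e⟩ | ⟨e, ⟨a, b, c, d, e', ha, hc, he⟩, rfl⟩ | ⟨L, h1, h2, rfl⟩
  · exact not_chaotic_of_semiconj (π := Prod.fst) continuous_fst Prod.fst_surjective
      (a := a) (b := b) (fun z => by rw [show z = (z.1, z.2) from rfl, e])
  · have e1 : ∀ x y, (sw * e) (x, y) = (c * y + (d * x + e'), a * x + b) := by
      intro x y
      rw [Homeomorph.mul_apply, he, sw_apply]
    obtain ⟨s, hs⟩ := IsAlgClosed.exists_pow_nat_eq (d ^ 2 + 4 * (c * a)) (n := 2) (by norm_num)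
    set l := (d + s) / 2 with hl
    have hll : l ^ 2 = d * l + c * a := by rw [hl]; linear_combination hs / 4
    have hl0 : l ≠ 0 := by
      intro h0
      rw [h0] at hll
      have : c * a = 0 := by linear_combination -hll
      exact mul_ne_zero hc ha this
    refine not_chaotic_of_semiconj (π := fun z : ℂ × ℂ => l * z.1 + c * z.2) (by fun_prop) ?_
      (a := l) (b := l * e' + c * b) ?_
    · intro w
      exact ⟨(w / l, 0), by simp; field_simp⟩
    · rintro ⟨x, y⟩
      rw [e1]
      simp only
      linear_combination -x * hll
  · exact (exp_wprod L h1 h2).not_chaotic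

lemma Chaotic.conj {X Y : Type*} [TopologicalSpace X] [TopologicalSpace Y] {f : X → X} {g : Y → Y}
    (k : X ≃ₜ Y) (h : ∀ x, k (f x) = g (k x)) (hf : Chaotic f) : Chaotic g := by
  have hsc : Function.Semiconj k f g := h
  have hit : ∀ n x, k (f^[n] x) = g^[n] (k x) := fun n x => (hsc.iterate_right n).eq x
  obtain ⟨⟨x, hx⟩, hp⟩ := hf
  refine ⟨⟨k x, ?_⟩, ?_⟩
  · have := k.surjective.denseRange.dense_image k.continuous hx
    rw [← Set.range_comp] at this
    convert this using 2
    funext n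
    exact (hit n x).symm
  · have := k.surjective.denseRange.dense_image k.continuous hp
    refine this.mono ?_
    rintro _ ⟨x, ⟨n, hn, hx⟩, rfl⟩
    exact ⟨n, hn, by rw [← hit, hx]⟩

lemma tame_not_chaotic {g : HH} (hg : g ∈ Tame) : ¬ Chaotic ⇑g := by
  obtain ⟨h, h1, h2⟩ := tame_nice hg
  rw [isConj_iff] at h2
  obtain ⟨c, rfl⟩ := h2
  intro hc
  refine h1.not_chaotic (hc.conj c ?_)
  intro x
  simp only [Homeomorph.mul_apply]
  congr 2
  rw [← Homeomorph.mul_apply]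
  simp

lemma final (f g : En 2 → En 2) (hf : IsPolyMap f) (hg : IsPolyMap g)
    (h1 : Function.LeftInverse g f) (h2 : Function.RightInverse g f) :
    ¬ Chaotic f := by
  obtain ⟨P, hP⟩ := hf 0
  obtain ⟨Q, hQ⟩ := hf 1
  obtain ⟨P', hP'⟩ := hg 0
  obtain ⟨Q', hQ'⟩ := hg 1
  let κ : En 2 ≃ₜ ℂ × ℂ :=
    { toFun := fun z => (z 0, z 1)
      invFun := fun z => !₂[z.1, z.2]
      left_inv := fun z => by ext i; fin_cases i <;> rfl
      right_inv := fun z => rfl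
      continuous_toFun := by fun_prop
      continuous_invFun := by fun_prop }
  have hfP : ∀ z, κ (f z) = (ev P (κ z), ev Q (κ z)) := by
    intro z
    have e : ![z 0, z 1] = fun j => z j := by ext i; fin_cases i <;> rfl
    show (f z 0, f z 1) = (eval ![z 0, z 1] P, eval ![z 0, z 1] Q)
    rw [hP, hQ, e]
  have hgP : ∀ z, κ (g z) = (ev P' (κ z), ev Q' (κ z)) := by
    intro z
    have e : ![z 0, z 1] = fun j => z j := by ext i; fin_cases i <;> rfl
    show (g z 0, g z 1) = (eval ![z 0, z 1] P', eval ![z 0, z 1] Q')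
    rw [hP', hQ', e]
  have hcont : ∀ R : A2, Continuous (ev R) := by
    intro R
    have := MvPolynomial.continuous_eval R
    exact this.comp (by fun_prop)
  let F : HH :=
    { toFun := fun z => (ev P z, ev Q z)
      invFun := fun z => (ev P' z, ev Q' z)
      left_inv := fun z => by
        obtain ⟨z, rfl⟩ := κ.surjective z
        simp only [← hfP, ← hgP, h1 z]
      right_inv := fun z => by
        obtain ⟨z, rfl⟩ := κ.surjective z
        simp only [← hfP, ← hgP, h2 z]
      continuous_toFun := (hcont P).prodMk (hcont Q)
      continuous_invFun := (hcont P').prodMk (hcont Q') }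
  have hF : F ∈ Tame := jung (F := F) (P := P) (Q := Q) (P' := P') (Q' := Q') (fun _ => rfl) (fun _ => rfl)
  intro hc
  exact tame_not_chaotic hF (hc.conj κ hfP)

end AuxG

/-- No polynomial automorphism of ℂ² is chaotic. -/
theorem stmt_4 (f g : En 2 → En 2) (hf : IsPolyMap f) (hg : IsPolyMap g)
    (h1 : Function.LeftInverse g f) (h2 : Function.RightInverse g f) :
    ¬ Chaotic f := by
  exact final f g hf hg h1 h2
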